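/- arXiv:1503.02164 — 6 statements merged into one kernel-verified Lean document; each statement's English description precedes it below -/
import Mathlib

section
/- Let X ∈ ℝ^{m×d}, D ∈ ℝ^{n×d}, and 0 < q₁ < q₂ ≤ 1, and let k ∈ ℕ. If X satisfies the D-NSPq₂ of order k (the sufficient and necessary condition for exact recovery of all vectors β with ‖Dβ‖_0 ≤ k via ℓ_{q₂}-analysis minimization), then X satisfies the D-NSPq₁ of order k; consequently, every β ∈ ℝ^d with ‖Dβ‖_0 ≤ k is the unique minimizer of the noiseless ℓ_{q₁}-analysis minimization problem with data y = Xβ. -/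
open scoped BigOperators

noncomputable section

/-- ℓq quasi-norm to the q-th power: `‖v‖_q^q = ∑ i |v i|^q`. -/
def lqq {n : ℕ} (q : ℝ) (v : Fin n → ℝ) : ℝ := ∑ i, |v i| ^ q

/-- number of nonzero entries of a vector (the ℓ0 "norm"). -/
def l0 {n : ℕ} (v : Fin n → ℝ) : ℕ := (Finset.univ.filter (fun i => v i ≠ 0)).card

/-- `β` is the unique minimizer of the noiseless ℓq-analysis minimization problem
`min ‖Dz‖_q^q  s.t. Xz = y`. -/
def UniqueMinimizer {m n d : ℕ} (q : ℝ) (X : Matrix (Fin m) (Fin d) ℝ)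
    (D : Matrix (Fin n) (Fin d) ℝ) (y : Fin m → ℝ) (β : Fin d → ℝ) : Prop :=
  X.mulVec β = y ∧
    ∀ z : Fin d → ℝ, X.mulVec z = y → z ≠ β →
      lqq q (D.mulVec β) < lqq q (D.mulVec z)

/-- `X` satisfies the D-NSPq relative to the index set `T`. -/
def DNSPqRel {m n d : ℕ} (q : ℝ) (X : Matrix (Fin m) (Fin d) ℝ)
    (D : Matrix (Fin n) (Fin d) ℝ) (T : Finset (Fin n)) : Prop :=
  ∀ v : Fin d → ℝ, X.mulVec v = 0 → v ≠ 0 →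
    ∑ i ∈ T, |(D.mulVec v) i| ^ q < ∑ i ∈ Tᶜ, |(D.mulVec v) i| ^ q

/-- `X` satisfies the D-NSPq of order `k`. -/
def DNSPq {m n d : ℕ} (q : ℝ) (X : Matrix (Fin m) (Fin d) ℝ)
    (D : Matrix (Fin n) (Fin d) ℝ) (k : ℕ) : Prop :=
  ∀ T : Finset (Fin n), T.card ≤ k → DNSPqRel q X D T

/-- Among the sets of a given size there is one carrying the largest sum of `a ^ q`, and its entries
dominate all the others. -/
lemma exists_card_eq_sum_rpow_le_and_dominates {ι : Type*} [Fintype ι] [DecidableEq ι] {a : ι → ℝ}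
    (ha : ∀ i, 0 ≤ a i) {q : ℝ} (hq : 0 < q) (T : Finset ι) :
    ∃ S : Finset ι, S.card = T.card ∧ ∑ i ∈ T, a i ^ q ≤ ∑ i ∈ S, a i ^ q ∧
      ∀ i ∈ S, ∀ j ∉ S, a j ≤ a i := by
  obtain ⟨S, hS, hmax⟩ := Finset.exists_max_image (Finset.powersetCard T.card Finset.univ)
    (fun S => ∑ i ∈ S, a i ^ q) ⟨T, by simp⟩
  have hcard : S.card = T.card := (Finset.mem_powersetCard.1 hS).2
  refine ⟨S, hcard, hmax T (by simp), fun i hi j hj => ?_⟩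
  have hj' : j ∉ S.erase i := fun h => hj (Finset.mem_of_mem_erase h)
  have hswap := hmax (insert j (S.erase i)) (Finset.mem_powersetCard.2 ⟨Finset.subset_univ _, by
    rw [Finset.card_insert_of_notMem hj', Finset.card_erase_add_one hi, hcard]⟩)
  rw [Finset.sum_insert hj', ← Finset.add_sum_erase S _ hi] at hswap
  exact (Real.rpow_le_rpow_iff (ha j) (ha i) hq).1 (le_of_add_le_add_right hswap)

/-- If the entries in `S` dominate the others, lowering the exponent preserves the strict inequality
between the sum over `S` and the sum over its complement. -/
lemma sum_rpow_lt_sum_compl_rpow_of_dominates {ι : Type*} [Fintype ι] [DecidableEq ι] {a : ι → ℝ}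
    (ha : ∀ i, 0 ≤ a i) {p q : ℝ} (hp : 0 < p) (hpq : p < q) {S : Finset ι}
    (hS : ∀ i ∈ S, ∀ j ∉ S, a j ≤ a i) (h : ∑ i ∈ S, a i ^ q < ∑ i ∈ Sᶜ, a i ^ q) :
    ∑ i ∈ S, a i ^ p < ∑ i ∈ Sᶜ, a i ^ p := by
  have hpos : 0 < ∑ i ∈ Sᶜ, a i ^ q :=
    (Finset.sum_nonneg fun i _ => Real.rpow_nonneg (ha i) q).trans_lt h
  obtain ⟨l, hl, hl0⟩ := Finset.exists_ne_zero_of_sum_ne_zero hpos.ne'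
  have hl' : 0 < a l := (ha l).lt_of_ne fun h0 =>
    hl0 (by rw [← h0, Real.zero_rpow (hp.trans hpq).ne'])
  obtain ⟨j, hj, hmax⟩ := Finset.exists_max_image Sᶜ a ⟨l, hl⟩
  have hc : 0 < a j := hl'.trans_le (hmax l hl)
  have split : ∀ i, 0 < a i → a i ^ p = a i ^ (p - q) * a i ^ q := fun i hi => by
    rw [← Real.rpow_add hi, sub_add_cancel]
  calc ∑ i ∈ S, a i ^ p ≤ ∑ i ∈ S, a j ^ (p - q) * a i ^ q := by
        refine Finset.sum_le_sum fun i hi => ?_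
        have hji := hS i hi j (Finset.mem_compl.1 hj)
        rw [split i (hc.trans_le hji)]
        exact mul_le_mul_of_nonneg_right
          (Real.rpow_le_rpow_of_nonpos hc hji (sub_nonpos.2 hpq.le)) (Real.rpow_nonneg (ha i) q)
    _ < ∑ i ∈ Sᶜ, a j ^ (p - q) * a i ^ q := by
        rw [← Finset.mul_sum, ← Finset.mul_sum]
        exact mul_lt_mul_of_pos_left h (Real.rpow_pos_of_pos hc _)
    _ ≤ ∑ i ∈ Sᶜ, a i ^ p := by
        refine Finset.sum_le_sum fun i hi => ?_
        rcases (ha i).eq_or_lt with h0 | h0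
        · rw [← h0, Real.zero_rpow (hp.trans hpq).ne', Real.zero_rpow hp.ne', mul_zero]
        · rw [split i h0]
          exact mul_le_mul_of_nonneg_right
            (Real.rpow_le_rpow_of_nonpos h0 (hmax i hi) (sub_nonpos.2 hpq.le))
            (Real.rpow_nonneg (ha i) q)

lemma DNSPq.anti {m n d : ℕ} {X : Matrix (Fin m) (Fin d) ℝ} {D : Matrix (Fin n) (Fin d) ℝ}
    {p q : ℝ} (hp : 0 < p) (hpq : p < q) {k : ℕ} (hN : DNSPq q X D k) : DNSPq p X D k := by
  intro T hT v hv hv0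
  have ha : ∀ i, 0 ≤ |(D.mulVec v) i| := fun i => abs_nonneg _
  obtain ⟨S, hcard, hle, hdom⟩ := exists_card_eq_sum_rpow_le_and_dominates ha hp T
  have hS := sum_rpow_lt_sum_compl_rpow_of_dominates ha hp hpq hdom
    (hN S (hcard.trans_le hT) v hv hv0)
  have hsumT := Finset.sum_add_sum_compl T fun i => |(D.mulVec v) i| ^ p
  have hsumS := Finset.sum_add_sum_compl S fun i => |(D.mulVec v) i| ^ p
  linarith

lemma abs_rpow_le_abs_add_rpow_add_abs_rpow {q : ℝ} (hq : 0 ≤ q) (hq1 : q ≤ 1) (x y : ℝ) :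
    |x| ^ q ≤ |x + y| ^ q + |y| ^ q :=
  calc |x| ^ q ≤ (|x + y| + |y|) ^ q :=
        Real.rpow_le_rpow (abs_nonneg x) (by simpa using abs_sub (x + y) y) hq
    _ ≤ |x + y| ^ q + |y| ^ q :=
        Real.rpow_add_le_add_rpow (abs_nonneg _) (abs_nonneg _) hq hq1

lemma DNSPq.uniqueMinimizer {m n d : ℕ} {X : Matrix (Fin m) (Fin d) ℝ}
    {D : Matrix (Fin n) (Fin d) ℝ} {q : ℝ} (hq : 0 < q) (hq1 : q ≤ 1) {k : ℕ}
    (hN : DNSPq q X D k) {β : Fin d → ℝ} (hβ : l0 (D.mulVec β) ≤ k) :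
    UniqueMinimizer q X D (X.mulVec β) β := by
  refine ⟨rfl, fun z hz hne => ?_⟩
  set T := Finset.univ.filter fun i => D.mulVec β i ≠ 0
  have hnsp := hN T hβ (z - β) (by rw [Matrix.mulVec_sub, hz, sub_self]) (sub_ne_zero.2 hne)
  have hβT : ∀ i ∈ Tᶜ, D.mulVec β i = 0 := fun i hi => by simpa [T] using hi
  have hT : ∑ i ∈ T, |D.mulVec β i| ^ q ≤
      ∑ i ∈ T, |D.mulVec z i| ^ q + ∑ i ∈ T, |D.mulVec (z - β) i| ^ q := by
    rw [← Finset.sum_add_distrib]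
    refine Finset.sum_le_sum fun i _ => ?_
    simpa [Matrix.mulVec_sub] using
      abs_rpow_le_abs_add_rpow_add_abs_rpow hq.le hq1 (D.mulVec β i) (D.mulVec (z - β) i)
  have hTc : ∑ i ∈ Tᶜ, |D.mulVec (z - β) i| ^ q = ∑ i ∈ Tᶜ, |D.mulVec z i| ^ q :=
    Finset.sum_congr rfl fun i hi => by simp [Matrix.mulVec_sub, hβT i hi]
  have hβTc : ∑ i ∈ Tᶜ, |D.mulVec β i| ^ q = 0 :=
    Finset.sum_eq_zero fun i hi => by simp [hβT i hi, hq.ne']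
  unfold lqq
  rw [← Finset.sum_add_sum_compl T, ← Finset.sum_add_sum_compl T fun i => |D.mulVec z i| ^ q]
  linarith

/-- for `0 < q₁ < q₂ ≤ 1`, the D-NSPq₂ of order `k` implies the D-NSPq₁ of
order `k`; consequently every `β` with `‖Dβ‖₀ ≤ k` is the unique minimizer of the noiseless
ℓ_{q₁}-analysis minimization problem with data `y = Xβ`. -/
theorem DNSPq_mono_and_recovery
    {m n d : ℕ} (X : Matrix (Fin m) (Fin d) ℝ) (D : Matrix (Fin n) (Fin d) ℝ)
    (q₁ q₂ : ℝ) (hq₁ : 0 < q₁) (hq₁₂ : q₁ < q₂) (hq₂ : q₂ ≤ 1)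
    (k : ℕ) (hN : DNSPq q₂ X D k) :
    DNSPq q₁ X D k ∧
      ∀ β : Fin d → ℝ, l0 (D.mulVec β) ≤ k →
        UniqueMinimizer q₁ X D (X.mulVec β) β := by
  have hN₁ := hN.anti hq₁ hq₁₂
  exact ⟨hN₁, fun β hβ => hN₁.uniqueMinimizer hq₁ (hq₁₂.le.trans hq₂) hβ⟩
end
end

section
/- Fix κ ≥ 1 and t ≥ 1. Then the function q ↦ (ρ(q)(1−κ⁴) + κ²√(4ρ(q)+1)) / (ρ(q)(κ²+1)² + κ²), where ρ(q) = t^{q−2}/4, is monotonically nonincreasing on (0,1]. In particular, the map ρ ↦ (ρ(1−κ⁴) + κ²√(4ρ+1)) / (ρ(κ²+1)² + κ²) is monotonically nonincreasing on (0,∞) for every κ ≥ 1. -/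
open scoped BigOperators

noncomputable section

/-- The right hand side bound `f(ρ,κ)` of the recovery sufficient condition. -/
def ripBound (ρ κ : ℝ) : ℝ :=
  (ρ * (1 - κ ^ 4) + κ ^ 2 * Real.sqrt (4 * ρ + 1)) / (ρ * (κ ^ 2 + 1) ^ 2 + κ ^ 2)

/-- In the variable `s = √(4ρ+1)`, numerator and denominator of `ripBound` share the factor
`(κ² + 1) s + (κ² - 1)`, which leaves a Möbius function of `s`. -/
theorem ripBound_eq_div {ρ κ : ℝ} (hρ : 0 ≤ ρ) (hκ : 1 ≤ κ) :
    ripBound ρ κ = (κ ^ 2 + 1 - (κ ^ 2 - 1) * √(4 * ρ + 1)) /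
      ((κ ^ 2 + 1) * √(4 * ρ + 1) - (κ ^ 2 - 1)) := by
  have hs : √(4 * ρ + 1) ^ 2 = 4 * ρ + 1 := Real.sq_sqrt (by linarith)
  have hs1 : 1 ≤ √(4 * ρ + 1) := Real.one_le_sqrt.2 (by linarith)
  unfold ripBound
  generalize √(4 * ρ + 1) = s at hs hs1 ⊢
  have hρs : ρ = (s ^ 2 - 1) / 4 := by linarith
  have hκ2 : 1 ≤ κ ^ 2 := one_le_pow₀ hκ
  have hden : 0 < (κ ^ 2 + 1) * s - (κ ^ 2 - 1) := by nlinarith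
  have hden' : 0 < ρ * (κ ^ 2 + 1) ^ 2 + κ ^ 2 := by positivity
  rw [div_eq_div_iff hden'.ne' hden.ne', hρs]
  ring

theorem antitoneOn_ripBound {κ : ℝ} (hκ : 1 ≤ κ) :
    AntitoneOn (fun ρ : ℝ => ripBound ρ κ) (Set.Ici 0) := by
  intro x hx y hy hxy
  have hx1 : 1 ≤ √(4 * x + 1) := Real.one_le_sqrt.2 (by linarith [Set.mem_Ici.1 hx])
  have hle : √(4 * x + 1) ≤ √(4 * y + 1) := Real.sqrt_le_sqrt (by linarith)
  simp only [ripBound_eq_div hx hκ, ripBound_eq_div hy hκ]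
  generalize √(4 * x + 1) = r at hx1 hle ⊢
  generalize √(4 * y + 1) = s at hle ⊢
  have hκ2 : 1 ≤ κ ^ 2 := one_le_pow₀ hκ
  have hden {u : ℝ} (hu : 1 ≤ u) : 0 < (κ ^ 2 + 1) * u - (κ ^ 2 - 1) := by nlinarith
  rw [div_le_div_iff₀ (hden (hx1.trans hle)) (hden hx1)]
  have key : 0 ≤ 4 * κ ^ 2 * (s - r) := mul_nonneg (by positivity) (sub_nonneg.2 hle)
  linear_combination key

/-- for `κ ≥ 1` and `t ≥ 1`, `q ↦ f(t^{q-2}/4, κ)` is monotonically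
nonincreasing on `(0,1]`; in particular `ρ ↦ f(ρ,κ)` is monotonically nonincreasing on
`(0,∞)` for every `κ ≥ 1`. -/
theorem ripBound_antitone (κ t : ℝ) (hκ : 1 ≤ κ) (ht : 1 ≤ t) :
    AntitoneOn (fun q : ℝ => ripBound (t ^ (q - 2) / 4) κ) (Set.Ioc (0 : ℝ) 1) ∧
      AntitoneOn (fun ρ : ℝ => ripBound ρ κ) (Set.Ioi (0 : ℝ)) := by
  refine ⟨fun p _ q _ hpq => ?_, (antitoneOn_ripBound hκ).mono Set.Ioi_subset_Ici_self⟩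
  have hpow (u : ℝ) : 0 ≤ t ^ (u - 2) / 4 := by positivity
  refine antitoneOn_ripBound hκ (hpow p) (hpow q) ?_
  gcongr
end
end

section
/- Let m, n, k, d ∈ ℕ with m < n, 4k < n, and let 0 < q ≤ 1. Let X ∈ ℝ^{m×d}, let D ∈ ℝ^{n×d} be surjective (full row rank), and let △ : ℝ^m → ℝ^n be any decoder. Suppose that for all β ∈ ℝ^d, ‖Dβ − △(Xβ)‖_q^q ≤ C·σ_k(Dβ)_q^q for some constant C > 0. Then the number of measurements must satisfy m ≥ C₁·q·k·log(n/(4k)), where C₁ = 1/(2·log(2C+3)). -/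
open scoped BigOperators

noncomputable section

/-- Best `k`-term approximation error of `u` in the ℓq quasi-norm:
`σ_k(u)_q = inf {‖u − z‖_q : ‖z‖₀ ≤ k}`. -/
def sigmaK {n : ℕ} (k : ℕ) (q : ℝ) (u : Fin n → ℝ) : ℝ :=
  sInf {r : ℝ | ∃ z : Fin n → ℝ, l0 z ≤ k ∧ r = (lqq q (u - z)) ^ (1 / q)}

lemma lqq_nonneg {n : ℕ} (q : ℝ) (v : Fin n → ℝ) : 0 ≤ lqq q v :=
  Finset.sum_nonneg fun _ _ => Real.rpow_nonneg (abs_nonneg _) _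

lemma lqq_neg {n : ℕ} (q : ℝ) (v : Fin n → ℝ) : lqq q (-v) = lqq q v := by
  simp [lqq]

lemma lqq_sub_comm {n : ℕ} (q : ℝ) (u v : Fin n → ℝ) : lqq q (u - v) = lqq q (v - u) := by
  rw [← lqq_neg, neg_sub]

lemma lqq_zero {n : ℕ} {q : ℝ} (hq : 0 < q) : lqq q (0 : Fin n → ℝ) = 0 := by
  simp [lqq, Real.zero_rpow hq.ne']

lemma lqq_add_le {n : ℕ} {q : ℝ} (hq0 : 0 < q) (hq1 : q ≤ 1) (u v : Fin n → ℝ) :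
    lqq q (u + v) ≤ lqq q u + lqq q v := by
  unfold lqq
  rw [← Finset.sum_add_distrib]
  refine Finset.sum_le_sum fun i _ => ?_
  calc |(u + v) i| ^ q ≤ (|u i| + |v i|) ^ q :=
        Real.rpow_le_rpow (abs_nonneg _) (abs_add_le _ _) hq0.le
    _ ≤ _ := Real.rpow_add_le_add_rpow (abs_nonneg _) (abs_nonneg _) hq0.le hq1

lemma lqq_smul {n : ℕ} {q c : ℝ} (hc : 0 ≤ c) (v : Fin n → ℝ) :
    lqq q (c • v) = c ^ q * lqq q v := by
  unfold lqq
  rw [Finset.mul_sum]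
  refine Finset.sum_congr rfl fun i _ => ?_
  rw [Pi.smul_apply, smul_eq_mul, abs_mul, abs_of_nonneg hc,
    Real.mul_rpow hc (abs_nonneg _)]

lemma continuous_lqq {n : ℕ} {q : ℝ} (hq : 0 < q) :
    Continuous (lqq q : (Fin n → ℝ) → ℝ) := by
  unfold lqq
  exact continuous_finsetSum _ fun i _ =>
    (continuous_apply i).abs.rpow_const fun _ => Or.inr hq.le

/-- The open unit ball of the ℓq quasi-norm. -/
def lqUnitBall (n : ℕ) (q : ℝ) : Set (Fin n → ℝ) := {v | lqq q v < 1}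

lemma isOpen_lqUnitBall {n : ℕ} {q : ℝ} (hq : 0 < q) : IsOpen (lqUnitBall n q) :=
  isOpen_lt (continuous_lqq hq) continuous_const

lemma zero_mem_lqUnitBall {n : ℕ} {q : ℝ} (hq : 0 < q) : 0 ∈ lqUnitBall n q := by
  simp [lqUnitBall, lqq_zero hq]

lemma isBounded_lqUnitBall {n : ℕ} {q : ℝ} (hq : 0 < q) :
    Bornology.IsBounded (lqUnitBall n q) := by
  refine (Metric.isBounded_closedBall (x := (0 : Fin n → ℝ)) (r := 1)).subset fun v hv => ?_
  rw [mem_closedBall_zero_iff, pi_norm_le_iff_of_nonneg zero_le_one]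
  intro i
  have h : |v i| ^ q ≤ lqq q v :=
    Finset.single_le_sum (f := fun i => |v i| ^ q)
      (fun _ _ => Real.rpow_nonneg (abs_nonneg _) _) (Finset.mem_univ i)
  by_contra! h1
  exact absurd (Real.one_lt_rpow h1 hq) (not_lt.2 (h.trans (le_of_lt hv)))

open scoped Pointwise in
lemma mem_smul_lqUnitBall {n : ℕ} {q s : ℝ} (hq : 0 < q) (hs : 0 < s) {v : Fin n → ℝ} :
    v ∈ s ^ (1 / q) • lqUnitBall n q ↔ lqq q v < s := by
  have hp : 0 < s ^ (1 / q) := Real.rpow_pos_of_pos hs _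
  rw [Set.mem_smul_set_iff_inv_smul_mem₀ hp.ne']
  change lqq q _ < 1 ↔ _
  rw [lqq_smul (inv_nonneg.2 hp.le), Real.inv_rpow hp.le, ← Real.rpow_mul hs.le,
    one_div_mul_cancel hq.ne', Real.rpow_one, inv_mul_lt_iff₀ hs, mul_one]

lemma sigmaK_rpow_le {n k : ℕ} {q : ℝ} (hq : 0 < q) (u z : Fin n → ℝ) (hz : l0 z ≤ k) :
    sigmaK k q u ^ q ≤ lqq q (u - z) := by
  have hlb : ∀ r ∈ {r : ℝ | ∃ z : Fin n → ℝ, l0 z ≤ k ∧ r = lqq q (u - z) ^ (1 / q)},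
      0 ≤ r := by
    rintro r ⟨z, -, rfl⟩
    exact Real.rpow_nonneg (lqq_nonneg _ _) _
  calc sigmaK k q u ^ q ≤ (lqq q (u - z) ^ (1 / q)) ^ q :=
        Real.rpow_le_rpow (Real.sInf_nonneg hlb) (csInf_le ⟨0, hlb⟩ ⟨z, hz, rfl⟩) hq.le
    _ = lqq q (u - z) := by
        rw [← Real.rpow_mul (lqq_nonneg _ _), one_div_mul_cancel hq.ne', Real.rpow_one]

/-- The indicator vector of a finite set of coordinates. -/
def indicatorVec {n : ℕ} (I : Finset (Fin n)) : Fin n → ℝ := fun i => if i ∈ I then 1 else 0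

lemma l0_indicatorVec {n : ℕ} (I : Finset (Fin n)) : l0 (indicatorVec I) = I.card := by
  simp [l0, indicatorVec]

lemma lqq_indicatorVec {n : ℕ} {q : ℝ} (hq : 0 < q) (I : Finset (Fin n)) :
    lqq q (indicatorVec I) = I.card := by
  have h : ∀ i, |indicatorVec I i| ^ q = if i ∈ I then (1 : ℝ) else 0 := by
    intro i
    by_cases hi : i ∈ I <;> simp [indicatorVec, hi, Real.zero_rpow hq.ne']
  simp [lqq, h]

lemma le_lqq_indicatorVec_sub {n k : ℕ} {q : ℝ} (hq : 0 < q) {I J : Finset (Fin n)}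
    (hI : I.card = k) (hJ : J.card = k) (hIJ : 2 * (I ∩ J).card ≤ k) :
    (k : ℝ) ≤ lqq q (indicatorVec I - indicatorVec J) := by
  have h : ∀ i, |(indicatorVec I - indicatorVec J) i| ^ q =
      (if i ∈ I \ J then (1 : ℝ) else 0) + if i ∈ J \ I then (1 : ℝ) else 0 := by
    intro i
    by_cases hi : i ∈ I <;> by_cases hj : i ∈ J <;>
      simp [indicatorVec, hi, hj, Real.zero_rpow hq.ne']
  have h1 := Finset.card_sdiff_add_card_inter I J
  have h2 := Finset.card_sdiff_add_card_inter J I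
  rw [Finset.inter_comm] at h2
  have h3 : k ≤ (I \ J).card + (J \ I).card := by omega
  have h4 : lqq q (indicatorVec I - indicatorVec J) = (I \ J).card + (J \ I).card := by
    simp only [lqq, h, Finset.sum_add_distrib, Finset.sum_ite_mem, Finset.univ_inter,
      Finset.sum_const, nsmul_eq_mul, mul_one]
  rw [h4]
  exact_mod_cast h3

lemma pow_mul_choose_le {n k : ℕ} (hkn : k ≤ n) (a : ℕ) :
    n ^ a * k.choose a ≤ k ^ a * n.choose a := by
  have h : n ^ a * k.descFactorial a ≤ k ^ a * n.descFactorial a := by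
    induction a with
    | zero => simp
    | succ a ih =>
      have h1 : n * (k - a) ≤ k * (n - a) := by
        rw [Nat.mul_sub, Nat.mul_sub, Nat.mul_comm n k]
        exact Nat.sub_le_sub_left (Nat.mul_le_mul_right a hkn) _
      rw [Nat.descFactorial_succ, Nat.descFactorial_succ]
      calc _ = n * (k - a) * (n ^ a * k.descFactorial a) := by ring
        _ ≤ k * (n - a) * (k ^ a * n.descFactorial a) := Nat.mul_le_mul h1 ih
        _ = _ := by ring
  rw [Nat.descFactorial_eq_factorial_mul_choose, Nat.descFactorial_eq_factorial_mul_choose] at h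
  refine Nat.le_of_mul_le_mul_left ?_ a.factorial_pos
  calc _ = n ^ a * (a.factorial * k.choose a) := by ring
    _ ≤ _ := h
    _ = _ := by ring

lemma card_filter_superset_le {α : Type*} [Fintype α] [DecidableEq α] (S : Finset α) (k : ℕ) :
    ((Finset.powersetCard k (Finset.univ : Finset α)).filter (S ⊆ ·)).card ≤
      (Fintype.card α - S.card).choose (k - S.card) := by
  rw [← Finset.card_compl, ← Finset.card_powersetCard]
  refine Finset.card_le_card_of_injOn (· \ S) (fun J hJ => ?_) fun J hJ J' hJ' h => ?_
  · simp only [Finset.coe_filter, Finset.mem_powersetCard_univ, Set.mem_ofPred_eq] at hJ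
    simp only [Finset.mem_coe, Finset.mem_powersetCard, Finset.card_sdiff_of_subset hJ.2, hJ.1,
      and_true]
    intro x hx
    simp_all
  · simp only [Finset.coe_filter, Set.mem_ofPred_eq] at hJ hJ'
    rw [← Finset.sdiff_union_of_subset hJ.2, ← Finset.sdiff_union_of_subset hJ'.2]
    exact congrArg (· ∪ S) h

/-- Greedy packing: a large family of `k`-sets with pairwise intersections smaller than `a`. -/
lemma exists_family_small_inter {n k a : ℕ} (hak : a ≤ k) (hkn : k ≤ n) :
    ∃ F : Finset (Finset (Fin n)), (∀ I ∈ F, I.card = k) ∧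
      (∀ I ∈ F, ∀ J ∈ F, I ≠ J → (I ∩ J).card < a) ∧
      n ^ a ≤ F.card * k.choose a * k ^ a := by
  classical
  let P := Finset.powersetCard k (Finset.univ : Finset (Fin n))
  let G := P.powerset.filter fun F => ∀ I ∈ F, ∀ J ∈ F, I ≠ J → (I ∩ J).card < a
  have hG : G.Nonempty := ⟨∅, by simp [G]⟩
  obtain ⟨F, hF, hmax⟩ := G.exists_max_image Finset.card hG
  simp only [G, Finset.mem_filter, Finset.mem_powerset] at hF
  have hcard : ∀ I ∈ F, I.card = k := fun I hI => by simpa [P] using hF.1 hI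
  have hcov : ∀ J ∈ P, ∃ I ∈ F, a ≤ (I ∩ J).card := by
    intro J hJ
    by_contra! hcon
    have hJF : J ∉ F := fun h => by
      have h1 := hcon J h
      rw [Finset.inter_self, show J.card = k by simpa [P] using hJ] at h1
      omega
    have hins : insert J F ∈ G := by
      simp only [G, Finset.mem_filter, Finset.mem_powerset]
      refine ⟨Finset.insert_subset hJ hF.1, fun I hI I' hI' hne => ?_⟩
      rcases Finset.mem_insert.1 hI with rfl | hIF <;>
        rcases Finset.mem_insert.1 hI' with rfl | hIF'
      · exact absurd rfl hne
      · rw [Finset.inter_comm]; exact hcon _ hIF'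
      · exact hcon _ hIF
      · exact hF.2 _ hIF _ hIF' hne
    have := hmax _ hins
    rw [Finset.card_insert_of_notMem hJF] at this
    omega
  refine ⟨F, hcard, hF.2, ?_⟩
  have hsub : P ⊆ F.biUnion fun I => (I.powersetCard a).biUnion fun S => P.filter (S ⊆ ·) := by
    intro J hJ
    obtain ⟨I, hI, hIJ⟩ := hcov J hJ
    obtain ⟨S, hS, hSa⟩ := Finset.exists_subset_card_eq hIJ
    simp only [Finset.mem_biUnion, Finset.mem_filter, Finset.mem_powersetCard]
    exact ⟨I, hI, S, ⟨hS.trans Finset.inter_subset_left, hSa⟩, hJ,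
      hS.trans Finset.inter_subset_right⟩
  have hcount : n.choose k ≤ F.card * (k.choose a * (n - a).choose (k - a)) := by
    calc n.choose k = P.card := by simp [P]
      _ ≤ _ := Finset.card_le_card hsub
      _ ≤ _ := Finset.card_biUnion_le_card_mul _ _ _ fun I hI => ?_
    rw [← hcard I hI, ← Finset.card_powersetCard a I, hcard I hI]
    refine Finset.card_biUnion_le_card_mul _ _ _ fun S hS => ?_
    have h := card_filter_superset_le S k
    rwa [(Finset.mem_powersetCard.1 hS).2, Fintype.card_fin] at h
  have hpos : 0 < (n - a).choose (k - a) := Nat.choose_pos (by omega)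
  have hchoose : n.choose a ≤ F.card * k.choose a * k.choose a := by
    refine Nat.le_of_mul_le_mul_right ?_ hpos
    rw [← Nat.choose_mul hak]
    calc _ ≤ F.card * (k.choose a * (n - a).choose (k - a)) * k.choose a :=
          Nat.mul_le_mul_right _ hcount
      _ = _ := by ring
  have hkpos : 0 < k.choose a := Nat.choose_pos hak
  refine Nat.le_of_mul_le_mul_right ?_ hkpos
  calc _ ≤ k ^ a * n.choose a := pow_mul_choose_le hkn a
    _ ≤ k ^ a * (F.card * k.choose a * k.choose a) := Nat.mul_le_mul_left _ hchoose
    _ = _ := by ring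

lemma exists_family_log_card {n k : ℕ} (hk : 0 < k) (hkn : k ≤ n) :
    ∃ F : Finset (Finset (Fin n)), (∀ I ∈ F, I.card = k) ∧
      (∀ I ∈ F, ∀ J ∈ F, I ≠ J → 2 * (I ∩ J).card ≤ k) ∧ 0 < F.card ∧
      (k : ℝ) / 2 * Real.log ((n : ℝ) / (4 * k)) ≤ Real.log F.card := by
  obtain ⟨F, hF, hinter, hcard⟩ :=
    exists_family_small_inter (a := (k + 1) / 2) (by omega : (k + 1) / 2 ≤ k) hkn
  set a := (k + 1) / 2 with ha
  have hpos : 0 < F.card := by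
    rcases Nat.eq_zero_or_pos F.card with h | h
    · rw [h, zero_mul, zero_mul] at hcard
      have : 0 < n ^ a := pow_pos (by omega) _
      omega
    · exact h
  refine ⟨F, hF, fun I hI J hJ hne => ?_, hpos, ?_⟩
  · have := hinter I hI J hJ hne
    omega
  have hkR : (0 : ℝ) < k := by exact_mod_cast hk
  have hnR : (0 : ℝ) < n := by exact_mod_cast hk.trans_le hkn
  have hFR : (0 : ℝ) < F.card := by exact_mod_cast hpos
  have h1 : (n : ℝ) ^ a ≤ F.card * 2 ^ k * k ^ a := by
    have : n ^ a ≤ F.card * 2 ^ k * k ^ a :=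
      hcard.trans (Nat.mul_le_mul_right _ (Nat.mul_le_mul_left _ (Nat.choose_le_two_pow _ _)))
    exact_mod_cast this
  have h2 := Real.log_le_log (by positivity) h1
  rw [Real.log_mul (by positivity) (by positivity), Real.log_mul (by positivity) (by positivity),
    Real.log_pow, Real.log_pow, Real.log_pow] at h2
  have h3 : Real.log k ≤ Real.log n := Real.log_le_log hkR (by exact_mod_cast hkn)
  have h4 : (k : ℝ) / 2 ≤ a := by
    have : k ≤ 2 * a := by omega
    have : (k : ℝ) ≤ 2 * a := by exact_mod_cast this
    linarith
  rw [Real.log_div hnR.ne' (by positivity), Real.log_mul (by norm_num) hkR.ne',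
    show (4 : ℝ) = 2 ^ 2 by norm_num, Real.log_pow]
  push_cast
  nlinarith [mul_nonneg (sub_nonneg.2 h4) (sub_nonneg.2 h3)]

section Packing

open scoped Pointwise
open MeasureTheory

/-- Volume packing bound for disjoint translates of `s • V` contained in `t • V`. -/
lemma card_mul_pow_le_of_disjoint_translates {ι : Type*} {r : ℕ} {V : Set (Fin r → ℝ)}
    (hVo : IsOpen V) (hVn : V.Nonempty) (hVb : Bornology.IsBounded V) {s t : ℝ} (hs : 0 < s)
    (ht : 0 < t) (F : Finset ι) (y : ι → Fin r → ℝ)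
    (hdisj : (F : Set ι).PairwiseDisjoint fun i => y i +ᵥ s • V)
    (hsub : ∀ i ∈ F, y i +ᵥ s • V ⊆ t • V) :
    F.card * s ^ r ≤ t ^ r := by
  have hpos : 0 < volume V := hVo.measure_pos _ hVn
  have hfin : volume V ≠ ⊤ := hVb.measure_lt_top.ne
  have hmeas : volume (⋃ i ∈ F, y i +ᵥ s • V) ≤ volume (t • V) :=
    measure_mono (Set.iUnion₂_subset hsub)
  rw [measure_biUnion_finset hdisj
    fun i _ => ((hVo.smul₀ hs.ne').vadd (y i)).measurableSet] at hmeas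
  simp only [measure_vadd, Measure.addHaar_smul, Module.finrank_fin_fun, Finset.sum_const,
    nsmul_eq_mul, ← mul_assoc] at hmeas
  rw [ENNReal.mul_le_mul_iff_left hpos.ne' hfin, abs_of_pos (pow_pos hs r),
    abs_of_pos (pow_pos ht r), ← ENNReal.ofReal_natCast, ← ENNReal.ofReal_mul (by positivity),
    ENNReal.ofReal_le_ofReal_iff (by positivity)] at hmeas
  exact hmeas

/-- The packing bound applied to the images of ℓq balls under a surjection `A` whose fibres
satisfy the instance-optimality inequality. -/
lemma log_card_le_of_fibre_bound {n k r : ℕ} {q C : ℝ} (hq0 : 0 < q) (hq1 : q ≤ 1) (hC : 0 < C)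
    (hk : 0 < k) (A : (Fin n → ℝ) →ₗ[ℝ] (Fin r → ℝ)) (hA : Function.Surjective A)
    (hfib : ∀ u v z w : Fin n → ℝ, A u = A v → l0 z ≤ k → l0 w ≤ k →
      lqq q (u - v) ≤ C * (lqq q (u - z) + lqq q (v - w)))
    (F : Finset (Finset (Fin n))) (hF : ∀ I ∈ F, I.card = k)
    (hinter : ∀ I ∈ F, ∀ J ∈ F, I ≠ J → 2 * (I ∩ J).card ≤ k) (hpos : 0 < F.card) :
    q * Real.log F.card ≤ r * Real.log (2 * C + 3) := by
  have hkR : (0 : ℝ) < k := by exact_mod_cast hk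
  set s : ℝ := k / (2 * C + 2) with hs_def
  have hs : 0 < s := by positivity
  have hsk : (2 * C + 2) * s = k := by rw [hs_def]; field_simp
  have hts : k + s = (2 * C + 3) * s := by linarith
  have hmem : ∀ (c : ℝ) (y : Fin r → ℝ), y ∈ c • (A '' lqUnitBall n q) ↔
      ∃ v ∈ c • lqUnitBall n q, A v = y := by
    intro c y
    rw [← Set.image_smul_comm]
    · rfl
    · intro v; exact map_smul A c v
  have hpack := card_mul_pow_le_of_disjoint_translates (V := A '' lqUnitBall n q)
    (s := s ^ (1 / q)) (t := (k + s) ^ (1 / q))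
    (A.isOpenMap_of_finiteDimensional hA _ (isOpen_lqUnitBall hq0))
    (Set.Nonempty.image _ ⟨0, zero_mem_lqUnitBall hq0⟩)
    (A.toContinuousLinearMap.lipschitz.isBounded_image (isBounded_lqUnitBall hq0))
    (by positivity) (by positivity) F (fun I => A (indicatorVec I)) ?_ ?_
  · rw [hts, Real.mul_rpow (by positivity) hs.le, mul_pow,
      mul_le_mul_iff_left₀ (by positivity)] at hpack
    have hlog := Real.log_le_log (by exact_mod_cast hpos) hpack
    rw [Real.log_pow, Real.log_rpow (by positivity)] at hlog
    calc q * Real.log F.card ≤ q * (r * (1 / q * Real.log (2 * C + 3))) :=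
          mul_le_mul_of_nonneg_left hlog hq0.le
      _ = _ := by field_simp
  · intro I hI J hJ hne
    refine Set.disjoint_left.2 fun y hy hy' => ?_
    obtain ⟨_, hy1, rfl⟩ := Set.mem_vadd_set.1 hy
    obtain ⟨_, hy2, heq⟩ := Set.mem_vadd_set.1 hy'
    obtain ⟨v, hv, rfl⟩ := (hmem _ _).1 hy1
    obtain ⟨w, hw, rfl⟩ := (hmem _ _).1 hy2
    rw [mem_smul_lqUnitBall hq0 hs] at hv hw
    simp only [vadd_eq_add, ← map_add] at heq
    have h1 := hfib _ _ (indicatorVec I) (indicatorVec J) heq.symm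
      (by rw [l0_indicatorVec, hF I hI]) (by rw [l0_indicatorVec, hF J hJ])
    rw [add_sub_cancel_left, add_sub_cancel_left] at h1
    have h2 := le_lqq_indicatorVec_sub hq0 (hF I hI) (hF J hJ) (hinter I hI J hJ hne)
    have h3 := lqq_add_le hq0 hq1 (indicatorVec I + v - (indicatorVec J + w)) (w - v)
    have h4 := lqq_add_le hq0 hq1 w (-v)
    rw [show indicatorVec I + v - (indicatorVec J + w) + (w - v) =
      indicatorVec I - indicatorVec J by abel] at h3
    rw [lqq_neg, ← sub_eq_add_neg] at h4
    nlinarith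
  · intro I hI y hy
    obtain ⟨_, hy1, rfl⟩ := Set.mem_vadd_set.1 hy
    obtain ⟨v, hv, rfl⟩ := (hmem _ _).1 hy1
    rw [mem_smul_lqUnitBall hq0 hs] at hv
    refine (hmem _ _).2 ⟨indicatorVec I + v, ?_, map_add A _ _⟩
    rw [mem_smul_lqUnitBall hq0 (by positivity)]
    have h := lqq_add_le hq0 hq1 (indicatorVec I) v
    rw [lqq_indicatorVec hq0, hF I hI] at h
    linarith

end Packing

/-- if a decoder `Δ` is instance optimal, i.e.
`‖Dβ − Δ(Xβ)‖_q^q ≤ C σ_k(Dβ)_q^q` for all `β`, then the number of measurements satisfies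
`m ≥ C₁ q k log(n/4k)` with `C₁ = 1/(2 log(2C+3))`. -/
theorem sample_complexity_lower_bound
    {m n d k : ℕ} (q C : ℝ) (hq0 : 0 < q) (hq1 : q ≤ 1) (hC : 0 < C)
    (hmn : m < n) (hkn : 4 * k < n)
    (X : Matrix (Fin m) (Fin d) ℝ) (D : Matrix (Fin n) (Fin d) ℝ)
    (hD : ∀ u : Fin n → ℝ, ∃ β : Fin d → ℝ, D.mulVec β = u)
    (Δ : (Fin m → ℝ) → (Fin n → ℝ))
    (hdec : ∀ β : Fin d → ℝ,
      lqq q (D.mulVec β - Δ (X.mulVec β)) ≤ C * (sigmaK k q (D.mulVec β)) ^ q) :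
    (m : ℝ) ≥ (1 / (2 * Real.log (2 * C + 3))) * q * k * Real.log ((n : ℝ) / (4 * k)) := by
  rcases Nat.eq_zero_or_pos k with rfl | hk
  · simp
  obtain ⟨E, hE⟩ := D.mulVecLin.exists_rightInverse_of_surjective (LinearMap.range_eq_top.2 hD)
  have hDE : ∀ u, D.mulVec (E u) = u := fun u => LinearMap.congr_fun hE u
  let A := X.mulVecLin ∘ₗ E
  let e := LinearEquiv.ofFinrankEq A.range (Fin (Module.finrank ℝ A.range) → ℝ)
    (Module.finrank_fin_fun ℝ).symm
  obtain ⟨F, hF, hinter, hpos, hlow⟩ := exists_family_log_card (n := n) hk (by omega)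
  have hup := log_card_le_of_fibre_bound hq0 hq1 hC hk (e.toLinearMap ∘ₗ A.rangeRestrict)
    (e.surjective.comp A.surjective_rangeRestrict) ?_ F hF hinter hpos
  · have hr : (Module.finrank ℝ A.range : ℝ) ≤ m := by
      have h := Submodule.finrank_le A.range
      rw [Module.finrank_fin_fun] at h
      exact_mod_cast h
    have hL : 0 < Real.log (2 * C + 3) := Real.log_pos (by linarith)
    have h1 := mul_le_mul_of_nonneg_left hlow hq0.le
    have h2 := mul_le_mul_of_nonneg_right hr hL.le
    calc _ = q * (k / 2 * Real.log (n / (4 * k))) / Real.log (2 * C + 3) := by field_simp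
      _ ≤ m := (div_le_iff₀ hL).2 (h1.trans (hup.trans h2))
  · intro u v z w huv hz hw
    have hA : X.mulVec (E u) = X.mulVec (E v) := congrArg Subtype.val (e.injective huv)
    have hu := hdec (E u)
    have hv := hdec (E v)
    rw [hDE] at hu hv
    rw [← hA, lqq_sub_comm] at hv
    have h := lqq_add_le hq0 hq1 (u - Δ (X.mulVec (E u))) (Δ (X.mulVec (E u)) - v)
    rw [sub_add_sub_cancel] at h
    have h1 := mul_le_mul_of_nonneg_left (sigmaK_rpow_le hq0 u z hz) hC.le
    have h2 := mul_le_mul_of_nonneg_left (sigmaK_rpow_le hq0 v w hw) hC.le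
    linarith
end
end

section
/- Let α ≥ 1 and 0 < q ≤ 1 with q < α, and let a ∈ ℝ^n. Then the infimum over all vectors η ∈ ℝ^n with η_i > 0 for all i of the quantity J(η) = (q/α)·Σ_{i=1}^n [ η_i·|a_i|^α + ((α−q)/q)·η_i^{−q/(α−q)} ] equals Σ_{i=1}^n |a_i|^q = ‖a‖_q^q. Moreover, if a_i ≠ 0 for all i, the infimum is attained at η_i = |a_i|^{q−α}, i = 1,…,n. -/
open scoped BigOperators

noncomputable section

/-- Young's inequality in the form of a bound on the weighted `ℓq` summand. -/
theorem rpow_le_weighted_summand {α q t η : ℝ} (hq : 0 < q) (hqα : q < α) (ht : 0 ≤ t)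
    (hη : 0 < η) :
    t ^ q ≤ (q / α) * (η * t ^ α + ((α - q) / q) * η ^ (-(q / (α - q)))) := by
  have hα : 0 < α := hq.trans hqα
  have hd : 0 < α - q := sub_pos.2 hqα
  have amgm := Real.geom_mean_le_arith_mean2_weighted (w₁ := q / α) (w₂ := (α - q) / α)
    (p₁ := η * t ^ α) (p₂ := η ^ (-(q / (α - q)))) (by positivity) (by positivity)
    (by positivity) (by positivity) (by field_simp; ring)
  have geom : (η * t ^ α) ^ (q / α) * (η ^ (-(q / (α - q)))) ^ ((α - q) / α) = t ^ q := by
    rw [Real.mul_rpow hη.le (by positivity), ← Real.rpow_mul ht, ← Real.rpow_mul hη.le,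
      mul_right_comm, ← Real.rpow_add hη,
      show q / α + -(q / (α - q)) * ((α - q) / α) = 0 by field_simp; ring,
      show α * (q / α) = q by field_simp, Real.rpow_zero, one_mul]
  rw [geom] at amgm
  refine amgm.trans_eq ?_
  field_simp

theorem weighted_summand_eq_rpow {α q t : ℝ} (hq : 0 < q) (hqα : q < α) (ht : 0 < t) :
    (q / α) * (t ^ (q - α) * t ^ α + ((α - q) / q) * (t ^ (q - α)) ^ (-(q / (α - q))))
      = t ^ q := by
  have hα : 0 < α := hq.trans hqα
  have hd : α - q ≠ 0 := (sub_pos.2 hqα).ne'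
  rw [← Real.rpow_add ht, ← Real.rpow_mul ht.le, sub_add_cancel,
    show (q - α) * -(q / (α - q)) = q by field_simp; ring]
  field_simp
  ring

theorem exists_weighted_summand_le_add {α q t ε : ℝ} (hq : 0 < q) (hqα : q < α) (ht : 0 ≤ t)
    (hε : 0 < ε) :
    ∃ η : ℝ, 0 < η ∧
      (q / α) * (η * t ^ α + ((α - q) / q) * η ^ (-(q / (α - q)))) ≤ t ^ q + ε := by
  have hα : 0 < α := hq.trans hqα
  have hd : 0 < α - q := sub_pos.2 hqα
  rcases ht.eq_or_lt with rfl | ht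
  · refine ⟨ε ^ (-((α - q) / q)), by positivity, ?_⟩
    rw [← Real.rpow_mul hε.le, show -((α - q) / q) * -(q / (α - q)) = 1 by field_simp,
      Real.rpow_one, Real.zero_rpow hα.ne', Real.zero_rpow hq.ne', mul_zero, zero_add, zero_add,
      ← mul_assoc, show q / α * ((α - q) / q) = (α - q) / α by field_simp]
    exact mul_le_of_le_one_left hε.le ((div_le_one hα).2 (by linarith))
  · exact ⟨t ^ (q - α), by positivity,
      (weighted_summand_eq_rpow hq hqα ht).le.trans (le_add_of_nonneg_right hε.le)⟩

/-- variational formulation of the ℓq quasi-norm. For `α ≥ 1`, `0 < q ≤ 1`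
with `q < α`, the infimum over positive weights `η` of
`J(η) = (q/α) ∑ᵢ [ηᵢ|aᵢ|^α + ((α−q)/q) ηᵢ^{−q/(α−q)}]` equals `∑ᵢ |aᵢ|^q`; if all `aᵢ ≠ 0`,
the infimum is attained at `ηᵢ = |aᵢ|^{q−α}`. -/
theorem lq_variational_formulation
    {n : ℕ} (α q : ℝ) (hα : 1 ≤ α) (hq0 : 0 < q) (hq1 : q ≤ 1) (hqα : q < α)
    (a : Fin n → ℝ) :
    sInf {r : ℝ | ∃ η : Fin n → ℝ, (∀ i, 0 < η i) ∧
        r = (q / α) * ∑ i, (η i * |a i| ^ α + ((α - q) / q) * (η i) ^ (-(q / (α - q))))}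
      = ∑ i, |a i| ^ q ∧
    ((∀ i, a i ≠ 0) →
      (q / α) * ∑ i, ((|a i| ^ (q - α)) * |a i| ^ α
          + ((α - q) / q) * (|a i| ^ (q - α)) ^ (-(q / (α - q))))
        = ∑ i, |a i| ^ q) := by
  refine ⟨IsGLB.csInf_eq ⟨?_, fun b hb ↦ le_of_forall_pos_le_add fun ε hε ↦ ?_⟩
    ⟨_, fun _ ↦ 1, fun _ ↦ one_pos, rfl⟩, fun ha ↦ ?_⟩
  · rintro r ⟨η, hη, rfl⟩
    rw [Finset.mul_sum]
    exact Finset.sum_le_sum fun i _ ↦ rpow_le_weighted_summand hq0 hqα (abs_nonneg _) (hη i)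
  · have hδ : 0 < ε / (n + 1) := by positivity
    choose η hη hle using fun i ↦ exists_weighted_summand_le_add hq0 hqα (abs_nonneg (a i)) hδ
    refine (hb ⟨η, hη, rfl⟩).trans ?_
    rw [Finset.mul_sum]
    refine (Finset.sum_le_sum fun i _ ↦ hle i).trans ?_
    rw [Finset.sum_add_distrib, Finset.sum_const, Finset.card_univ, Fintype.card_fin,
      nsmul_eq_mul]
    gcongr
    rw [mul_div_assoc', div_le_iff₀ (by positivity)]
    linarith
  · rw [Finset.mul_sum]
    exact Finset.sum_congr rfl fun i _ ↦ weighted_summand_eq_rpow hq0 hqα (abs_pos.2 (ha i))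
end
end

section
/- Let X ∈ ℝ^{m×d}, y ∈ ℝ^m, λ > 0, 0 < q ≤ 1 ≤ α, and let D ∈ ℝ^{n×d} have full column rank with smallest singular value σ_min(D) > 0. Define F(β,ε) = (1/2)‖y − Xβ‖₂² + λ·Σ_{i=1}^n (|(Dβ)_i|^α + ε^α)^{q/α} for β ∈ ℝ^d and ε ≥ 0. Then for every β ∈ ℝ^d and ε ≥ 0, ‖β‖₂ ≤ σ_min(D)^{−1}·(F(β,ε)/λ)^{1/q}. In particular, any sequence of iterates (β^{(k)}, ε^{(k)}) along which F is nonincreasing satisfies ‖β^{(k)}‖₂ ≤ σ_min(D)^{−1}·(F(β^{(0)},ε^{(0)})/λ)^{1/q} for all k. -/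
open scoped BigOperators

noncomputable section

/-- Euclidean norm. -/
def l2 {n : ℕ} (v : Fin n → ℝ) : ℝ := Real.sqrt (∑ i, (v i) ^ 2)

/-- Minimal (nonzero, for full column rank `D`) singular value of `D`
(as the infimum of `‖Dv‖₂/‖v‖₂`). -/
def sigmaMin {n d : ℕ} (D : Matrix (Fin n) (Fin d) ℝ) : ℝ :=
  sInf {r : ℝ | ∃ v : Fin d → ℝ, v ≠ 0 ∧ r = l2 (D.mulVec v) / l2 v}

/-- The smoothed objective of the CoIRLq algorithm:
`F(β,ε) = (1/2)‖y − Xβ‖₂² + λ ∑ᵢ (|(Dβ)ᵢ|^α + ε^α)^{q/α}`. -/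
def Fobj {m n d : ℕ} (X : Matrix (Fin m) (Fin d) ℝ) (D : Matrix (Fin n) (Fin d) ℝ)
    (y : Fin m → ℝ) (lam α q : ℝ) (β : Fin d → ℝ) (ε : ℝ) : ℝ :=
  (1 / 2) * (l2 (y - X.mulVec β)) ^ 2
    + lam * ∑ i, (|(D.mulVec β) i| ^ α + ε ^ α) ^ (q / α)

theorem l2_nonneg {n : ℕ} (v : Fin n → ℝ) : 0 ≤ l2 v := Real.sqrt_nonneg _

theorem l2_pos {n : ℕ} {v : Fin n → ℝ} (hv : v ≠ 0) : 0 < l2 v := by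
  obtain ⟨i, hi⟩ := Function.ne_iff.mp hv
  exact Real.sqrt_pos.mpr (Finset.sum_pos' (fun j _ => sq_nonneg (v j))
    ⟨i, Finset.mem_univ i, by simpa [sq_pos_iff] using hi⟩)

theorem l2_le_sum_abs_rpow {n : ℕ} (u : Fin n → ℝ) {q : ℝ} (hq0 : 0 < q) (hq2 : q ≤ 2) :
    l2 u ≤ (∑ i, |u i| ^ q) ^ (1 / q) := by
  have hS : 0 ≤ ∑ i, |u i| ^ q :=
    Finset.sum_nonneg fun i _ => Real.rpow_nonneg (abs_nonneg _) _
  set T := (∑ i, |u i| ^ q) ^ (1 / q) with hT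
  have hT0 : 0 ≤ T := Real.rpow_nonneg hS _
  have hTq : T ^ q = ∑ i, |u i| ^ q := by
    rw [hT, ← Real.rpow_mul hS, one_div_mul_cancel hq0.ne', Real.rpow_one]
  have split {x : ℝ} (hx : 0 ≤ x) : x ^ 2 = x ^ q * x ^ (2 - q) := by
    rw [← Real.rpow_add' hx (by norm_num), add_sub_cancel, Real.rpow_two]
  have le_T (i : Fin n) : |u i| ≤ T := by
    rw [← Real.rpow_le_rpow_iff (abs_nonneg _) hT0 hq0, hTq]
    exact Finset.single_le_sum (f := fun j => |u j| ^ q)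
      (fun j _ => Real.rpow_nonneg (abs_nonneg _) _) (Finset.mem_univ i)
  refine Real.sqrt_le_iff.mpr ⟨hT0, ?_⟩
  calc ∑ i, u i ^ 2 = ∑ i, |u i| ^ q * |u i| ^ (2 - q) :=
        Finset.sum_congr rfl fun i _ => by rw [← split (abs_nonneg _), sq_abs]
    _ ≤ ∑ i, |u i| ^ q * T ^ (2 - q) := Finset.sum_le_sum fun i _ =>
        mul_le_mul_of_nonneg_left
          (Real.rpow_le_rpow (abs_nonneg _) (le_T i) (sub_nonneg.mpr hq2))
          (Real.rpow_nonneg (abs_nonneg _) _)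
    _ = T ^ 2 := by rw [← Finset.sum_mul, ← hTq, ← split hT0]

theorem sigmaMin_mul_l2_le {n d : ℕ} (D : Matrix (Fin n) (Fin d) ℝ) (v : Fin d → ℝ) :
    sigmaMin D * l2 v ≤ l2 (D.mulVec v) := by
  rcases eq_or_ne v 0 with rfl | hv
  · simp [l2]
  · rw [← le_div_iff₀ (l2_pos hv)]
    refine csInf_le ⟨0, ?_⟩ ⟨v, hv, rfl⟩
    rintro _ ⟨w, -, rfl⟩
    exact div_nonneg (l2_nonneg _) (l2_nonneg _)

theorem sum_abs_rpow_le_Fobj_div {m n d : ℕ} (X : Matrix (Fin m) (Fin d) ℝ)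
    (D : Matrix (Fin n) (Fin d) ℝ) (y : Fin m → ℝ) {lam α q : ℝ} (hlam : 0 < lam)
    (hq : 0 ≤ q) (hα : 0 < α) (β : Fin d → ℝ) {ε : ℝ} (hε : 0 ≤ ε) :
    ∑ i, |(D.mulVec β) i| ^ q ≤ Fobj X D y lam α q β ε / lam := by
  rw [le_div_iff₀' hlam]
  have term_le (i : Fin n) :
      |(D.mulVec β) i| ^ q ≤ (|(D.mulVec β) i| ^ α + ε ^ α) ^ (q / α) := by
    calc |(D.mulVec β) i| ^ q = (|(D.mulVec β) i| ^ α) ^ (q / α) := by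
          rw [← Real.rpow_mul (abs_nonneg _), mul_div_cancel₀ _ hα.ne']
      _ ≤ _ := Real.rpow_le_rpow (Real.rpow_nonneg (abs_nonneg _) _)
          (le_add_of_nonneg_right (Real.rpow_nonneg hε _)) (div_nonneg hq hα.le)
  exact (mul_le_mul_of_nonneg_left (Finset.sum_le_sum fun i _ => term_le i) hlam.le).trans
    (le_add_of_nonneg_left (by positivity))

/-- the iterates of the CoIRLq algorithm are bounded:
`‖β‖₂ ≤ σ_min(D)⁻¹ (F(β,ε)/λ)^{1/q}`, hence any sequence of iterates along which `F` is
nonincreasing is bounded by `σ_min(D)⁻¹ (F(β⁽⁰⁾,ε⁽⁰⁾)/λ)^{1/q}`. -/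
theorem coirlq_iterates_bounded
    {m n d : ℕ} (X : Matrix (Fin m) (Fin d) ℝ) (D : Matrix (Fin n) (Fin d) ℝ)
    (y : Fin m → ℝ) (lam α q : ℝ)
    (hlam : 0 < lam) (hq0 : 0 < q) (hq1 : q ≤ 1) (hα : 1 ≤ α)
    (hfull : ∀ v : Fin d → ℝ, D.mulVec v = 0 → v = 0) (hσ : 0 < sigmaMin D) :
    (∀ (β : Fin d → ℝ) (ε : ℝ), 0 ≤ ε →
      l2 β ≤ (sigmaMin D)⁻¹ * (Fobj X D y lam α q β ε / lam) ^ (1 / q)) ∧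
    ∀ (βs : ℕ → Fin d → ℝ) (εs : ℕ → ℝ), (∀ k, 0 ≤ εs k) →
      (∀ k, Fobj X D y lam α q (βs (k + 1)) (εs (k + 1))
              ≤ Fobj X D y lam α q (βs k) (εs k)) →
      ∀ k, l2 (βs k) ≤ (sigmaMin D)⁻¹ * (Fobj X D y lam α q (βs 0) (εs 0) / lam) ^ (1 / q) := by
  have hα0 : 0 < α := one_pos.trans_le hα
  have sum_nonneg (β : Fin d → ℝ) : 0 ≤ ∑ i, |(D.mulVec β) i| ^ q :=
    Finset.sum_nonneg fun i _ => Real.rpow_nonneg (abs_nonneg _) _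
  have bound (β : Fin d → ℝ) (ε : ℝ) (hε : 0 ≤ ε) :
      l2 β ≤ (sigmaMin D)⁻¹ * (Fobj X D y lam α q β ε / lam) ^ (1 / q) := by
    rw [le_inv_mul_iff₀ hσ]
    calc sigmaMin D * l2 β ≤ l2 (D.mulVec β) := sigmaMin_mul_l2_le D β
      _ ≤ (∑ i, |(D.mulVec β) i| ^ q) ^ (1 / q) :=
          l2_le_sum_abs_rpow _ hq0 (hq1.trans one_le_two)
      _ ≤ _ := Real.rpow_le_rpow (sum_nonneg β)
          (sum_abs_rpow_le_Fobj_div X D y hlam hq0.le hα0 β hε) (one_div_pos.mpr hq0).le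
  refine ⟨bound, fun βs εs hε hmono k => (bound (βs k) (εs k) (hε k)).trans ?_⟩
  have hF := antitone_nat_of_succ_le (f := fun k => Fobj X D y lam α q (βs k) (εs k)) hmono
    (Nat.zero_le k)
  exact mul_le_mul_of_nonneg_left
    (Real.rpow_le_rpow
      ((sum_nonneg _).trans (sum_abs_rpow_le_Fobj_div X D y hlam hq0.le hα0 _ (hε k)))
      (div_le_div_of_nonneg_right hF hlam.le) (one_div_pos.mpr hq0).le)
    (inv_nonneg.mpr hσ.le)
end
end

section
/- Let X ∈ ℝ^{m×d}, D ∈ ℝ^{n×d}, y ∈ ℝ^m, λ > 0, 0 < q ≤ 1 ≤ α with q < α. Define F(β,ε) = (1/2)‖y − Xβ‖₂² + λ·Σ_{i=1}^n (|(Dβ)_i|^α + ε^α)^{q/α}. Fix β₀ ∈ ℝ^d and ε₀ > 0, and set η_i = (|(Dβ₀)_i|^α + ε₀^α)^{q/α − 1} for i = 1,…,n. Then: (i) for every β ∈ ℝ^d and ε ≥ 0, F(β,ε) ≤ Q(β,ε) := (1/2)‖y − Xβ‖₂² + (λq/α)·Σ_{i=1}^n [ η_i·(|(Dβ)_i|^α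 + ε^α) + ((α−q)/q)·η_i^{−q/(α−q)} ], with equality F(β₀,ε₀) = Q(β₀,ε₀); (ii) consequently, if β₁ minimizes β ↦ (1/2)‖y − Xβ‖₂² + (λq/α)·Σ_{i=1}^n η_i·|(Dβ)_i|^α over ℝ^d and 0 ≤ ε₁ ≤ ε₀, then F(β₁,ε₁) ≤ F(β₀,ε₀). -/
open scoped BigOperators

noncomputable section

/-- The majorizing surrogate objective with weights `η`:
`Q(β,ε) = (1/2)‖y − Xβ‖₂² + (λq/α) ∑ᵢ [ηᵢ(|(Dβ)ᵢ|^α + ε^α) + ((α−q)/q) ηᵢ^{−q/(α−q)}]`. -/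
def Qobj {m n d : ℕ} (X : Matrix (Fin m) (Fin d) ℝ) (D : Matrix (Fin n) (Fin d) ℝ)
    (y : Fin m → ℝ) (lam α q : ℝ) (η : Fin n → ℝ) (β : Fin d → ℝ) (ε : ℝ) : ℝ :=
  (1 / 2) * (l2 (y - X.mulVec β)) ^ 2
    + (lam * q / α) * ∑ i,
        (η i * (|(D.mulVec β) i| ^ α + ε ^ α)
          + ((α - q) / q) * (η i) ^ (-(q / (α - q))))

/-- Tangent-line bound for the concave power function `s ↦ s ^ p`, `0 ≤ p ≤ 1`. -/
theorem Real.rpow_le_tangent_line {p s t : ℝ} (hp0 : 0 ≤ p) (hp1 : p ≤ 1) (hs : 0 ≤ s)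
    (ht : 0 < t) : s ^ p ≤ p * (t ^ (p - 1) * s) + (1 - p) * t ^ p := by
  have amgm := Real.geom_mean_le_arith_mean2_weighted hp0 (sub_nonneg.2 hp1) hs ht.le
    (add_sub_cancel p 1)
  have h1 : t ^ (1 - p) * t ^ (p - 1) = 1 := by
    rw [← Real.rpow_add ht]; simp
  have h2 : t * t ^ (p - 1) = t ^ p := by
    nth_rewrite 1 [← Real.rpow_one t]
    rw [← Real.rpow_add ht, add_sub_cancel]
  calc s ^ p = s ^ p * t ^ (1 - p) * t ^ (p - 1) := by rw [mul_assoc, h1, mul_one]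
    _ ≤ (p * s + (1 - p) * t) * t ^ (p - 1) := by gcongr
    _ = p * (t ^ (p - 1) * s) + (1 - p) * t ^ p := by rw [← h2]; ring

theorem Real.rpow_sub_one_rpow_neg_div {α q t : ℝ} (hα : α ≠ 0) (hqα : q < α) (ht : 0 ≤ t) :
    (t ^ (q / α - 1)) ^ (-(q / (α - q))) = t ^ (q / α) := by
  have : α - q ≠ 0 := (sub_pos.2 hqα).ne'
  rw [← Real.rpow_mul ht]
  congr 1
  field_simp
  ring

/-- The surrogate `Qobj` with each summand written as a tangent line of `s ↦ s ^ (q / α)`. -/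
theorem Qobj_eq_tangent_line {m n d : ℕ} (X : Matrix (Fin m) (Fin d) ℝ)
    (D : Matrix (Fin n) (Fin d) ℝ) (y : Fin m → ℝ) (lam : ℝ) {α q : ℝ}
    (hq0 : q ≠ 0) (hα : α ≠ 0) (hqα : q < α) {η t : Fin n → ℝ} (ht : ∀ i, 0 ≤ t i)
    (hη : ∀ i, η i = t i ^ (q / α - 1)) (β : Fin d → ℝ) (ε : ℝ) :
    Qobj X D y lam α q η β ε = (1 / 2) * (l2 (y - X.mulVec β)) ^ 2
      + lam * ∑ i, (q / α * (t i ^ (q / α - 1) * (|(D.mulVec β) i| ^ α + ε ^ α))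
        + (1 - q / α) * t i ^ (q / α)) := by
  unfold Qobj
  rw [mul_div_assoc, mul_assoc, Finset.mul_sum]
  congr 3 with i
  rw [hη i, Real.rpow_sub_one_rpow_neg_div hα hqα (ht i)]
  field_simp

/-- majorization and monotone decrease for the CoIRLq algorithm. With
`ηᵢ = (|(Dβ₀)ᵢ|^α + ε₀^α)^{q/α−1}`: (i) `F ≤ Q` everywhere with equality at `(β₀,ε₀)`;
(ii) if `β₁` minimizes the weighted ℓ_α objective and `0 ≤ ε₁ ≤ ε₀`, then
`F(β₁,ε₁) ≤ F(β₀,ε₀)`. -/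
theorem coirlq_majorization_and_descent
    {m n d : ℕ} (X : Matrix (Fin m) (Fin d) ℝ) (D : Matrix (Fin n) (Fin d) ℝ)
    (y : Fin m → ℝ) (lam α q : ℝ)
    (hlam : 0 < lam) (hq0 : 0 < q) (hq1 : q ≤ 1) (hα : 1 ≤ α) (hqα : q < α)
    (β₀ : Fin d → ℝ) (ε₀ : ℝ) (hε₀ : 0 < ε₀) (η : Fin n → ℝ)
    (hη : ∀ i, η i = (|(D.mulVec β₀) i| ^ α + ε₀ ^ α) ^ (q / α - 1)) :
    (∀ (β : Fin d → ℝ) (ε : ℝ), 0 ≤ ε →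
        Fobj X D y lam α q β ε ≤ Qobj X D y lam α q η β ε) ∧
    Fobj X D y lam α q β₀ ε₀ = Qobj X D y lam α q η β₀ ε₀ ∧
    ∀ (β₁ : Fin d → ℝ) (ε₁ : ℝ), 0 ≤ ε₁ → ε₁ ≤ ε₀ →
      (∀ β : Fin d → ℝ,
        (1 / 2) * (l2 (y - X.mulVec β₁)) ^ 2
            + (lam * q / α) * ∑ i, η i * |(D.mulVec β₁) i| ^ α
          ≤ (1 / 2) * (l2 (y - X.mulVec β)) ^ 2
            + (lam * q / α) * ∑ i, η i * |(D.mulVec β) i| ^ α) →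
      Fobj X D y lam α q β₁ ε₁ ≤ Fobj X D y lam α q β₀ ε₀ := by
  have hα0 : 0 < α := hq0.trans hqα
  have ht : ∀ i, 0 < |(D.mulVec β₀) i| ^ α + ε₀ ^ α := fun i => by positivity
  have hQ := Qobj_eq_tangent_line X D y lam hq0.ne' hα0.ne' hqα (fun i => (ht i).le) hη
  have majorize : ∀ (β : Fin d → ℝ) (ε : ℝ), 0 ≤ ε →
      Fobj X D y lam α q β ε ≤ Qobj X D y lam α q η β ε := by
    intro β ε hε
    rw [hQ, Fobj]
    gcongr with i
    exact Real.rpow_le_tangent_line (by positivity) ((div_le_one hα0).2 hqα.le)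
      (by positivity) (ht i)
  have touch : Fobj X D y lam α q β₀ ε₀ = Qobj X D y lam α q η β₀ ε₀ := by
    rw [hQ, Fobj]
    congr 3 with i
    rw [← Real.rpow_add_one (ht i).ne', sub_add_cancel]
    ring
  refine ⟨majorize, touch, fun β₁ ε₁ hε₁ hε hmin => ?_⟩
  rw [touch]
  refine (majorize β₁ ε₁ hε₁).trans ?_
  have hsmooth : (lam * q / α) * ∑ i, η i * ε₁ ^ α ≤ (lam * q / α) * ∑ i, η i * ε₀ ^ α := by
    gcongr with i
    rw [hη i]
    exact Real.rpow_nonneg (ht i).le _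
  have := hmin β₀
  simp only [Qobj, mul_add, Finset.sum_add_distrib]
  linarith
end
end
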